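/- For m ≥ 1 let F^I_m(q, t) = Σ_{σ ∈ AndI_m} t^{des(σ)} q^{inv(σ)} ∈ ℤ[q, t] be the descent–inversion polynomial of André I permutations of [m]. Then for every n ≥ 1, F^I_{n+1}(q, t) = F^I_n(q, t) + Σ_{k=0}^{n−2} q^{n−k−1} [n−1 choose k]_q · F^I_{k+1}(q, t) · F^I_{n−k−1}(q, t), where the sum is empty when n = 1 and [n−1 choose k]_q is the Gaussian binomial coefficient. -/

import Mathlib

namespace PermStats

/-- The word of a permutation `σ` of `[n] = {1,…,n}` with the boundary convention
`σ_0 = σ_{n+1} = 0`: position `i` (for `1 ≤ i ≤ n`) holds the value `σ(i) ∈ [n]`,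
and every other position holds `0`. -/
def wval (n : ℕ) (σ : Equiv.Perm (Fin n)) (i : ℕ) : ℕ :=
  if h : 1 ≤ i ∧ i ≤ n then ((σ ⟨i - 1, by omega⟩ : Fin n) : ℕ) + 1 else 0

/-- `des(σ) = #{i : 0 ≤ i ≤ n, σ_i > σ_{i+1}}`. -/
def des (n : ℕ) (σ : Equiv.Perm (Fin n)) : ℕ :=
  ((Finset.range (n + 1)).filter fun i => wval n σ (i + 1) < wval n σ i).card

/-- `asc(σ) = #{i : 0 ≤ i ≤ n, σ_i < σ_{i+1}}`. -/
def asc (n : ℕ) (σ : Equiv.Perm (Fin n)) : ℕ :=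
  ((Finset.range (n + 1)).filter fun i => wval n σ i < wval n σ (i + 1)).card

/-- `inv(σ) = #{(i,j) : 1 ≤ i < j ≤ n, σ_i > σ_j}`. -/
def inv (n : ℕ) (σ : Equiv.Perm (Fin n)) : ℕ :=
  (Finset.univ.filter fun p : Fin n × Fin n => p.1 < p.2 ∧ σ p.2 < σ p.1).card

end PermStats

namespace Andre

/-- The word `σ(1) σ(2) ⋯ σ(n)` (with values in `[n] = {1,…,n}`) of a permutation
`σ` of `[n]`. -/
def permWord (n : ℕ) (σ : Equiv.Perm (Fin n)) : List ℕ :=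
  List.ofFn fun i : Fin n => ((σ i : Fin n) : ℕ) + 1

/-- André I permutations (as words of distinct positive integers): the empty word and
single letters are André I, and a word `w = τ m τ'` whose minimum letter is `m` is
André I when both `τ` and `τ'` are André I and the maximum letter of `τ τ'` lies
in `τ'`. -/
inductive IsAndreI : List ℕ → Prop where
  | nil : IsAndreI []
  | single (a : ℕ) : IsAndreI [a]
  | node (τ τ' : List ℕ) (m M : ℕ) :
      IsAndreI τ → IsAndreI τ' →
      (∀ a ∈ τ ++ τ', m < a) →
      M ∈ τ' → (∀ a ∈ τ ++ τ', a ≤ M) →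
      IsAndreI (τ ++ m :: τ')

/-- André II permutations (as words of distinct positive integers): the empty word and
single letters are André II, and a word `w = τ m τ'` whose minimum letter is `m` is
André II when both `τ` and `τ'` are André II and the minimum letter of `τ τ'` lies
in `τ'`. -/
inductive IsAndreII : List ℕ → Prop where
  | nil : IsAndreII []
  | single (a : ℕ) : IsAndreII [a]
  | node (τ τ' : List ℕ) (m m' : ℕ) :
      IsAndreII τ → IsAndreII τ' →
      (∀ a ∈ τ ++ τ', m < a) →
      m' ∈ τ' → (∀ a ∈ τ ++ τ', m' ≤ a) →
      IsAndreII (τ ++ m :: τ')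

/-- The set of André I permutations of `[n]`, as a finset of `Equiv.Perm (Fin n)`. -/
noncomputable def andreIFinset (n : ℕ) : Finset (Equiv.Perm (Fin n)) :=
  @Finset.filter _ (fun σ => IsAndreI (permWord n σ)) (Classical.decPred _) Finset.univ

/-- The set of André II permutations of `[n]`, as a finset of `Equiv.Perm (Fin n)`. -/
noncomputable def andreIIFinset (n : ℕ) : Finset (Equiv.Perm (Fin n)) :=
  @Finset.filter _ (fun σ => IsAndreII (permWord n σ)) (Classical.decPred _) Finset.univ

end Andre

/-- The Gaussian binomial coefficient `[n choose k]_q`, defined by the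
q-Pascal recurrence `[n+1, k+1] = [n, k] + q^{k+1}·[n, k+1]`; it equals
`((1-q^n)⋯(1-q^{n-k+1}))/((1-q^k)⋯(1-q))` for `0 ≤ k ≤ n` and `0` for `k > n`. -/
def qBinom {R : Type*} [CommRing R] (q : R) : ℕ → ℕ → R
  | _, 0 => 1
  | 0, _ + 1 => 0
  | n + 1, k + 1 => qBinom q n k + q ^ (k + 1) * qBinom q n (k + 1)

open PermStats Andre

/-- The descent–inversion polynomial `F^I_m(q, t) = Σ_{σ ∈ AndI_m} t^{des σ} q^{inv σ}`
of André I permutations of `[m]`, as an element of `ℤ[q][t] = Polynomial (Polynomial ℤ)`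
(`q` the inner and `t` the outer variable). -/
noncomputable def FI (m : ℕ) : Polynomial (Polynomial ℤ) :=
  ∑ σ ∈ andreIFinset m,
    Polynomial.X ^ des m σ * Polynomial.C (Polynomial.X ^ inv m σ)

namespace Andre

open Polynomial

/-- The number of descents of the word `a l 0`. -/
def desFrom : ℕ → List ℕ → ℕ
  | a, [] => if 0 < a then 1 else 0
  | a, b :: l => (if b < a then 1 else 0) + desFrom b l

/-- The number of inversions of a word. -/
def wordInv : List ℕ → ℕ
  | [] => 0
  | a :: l => l.countP (· < a) + wordInv l

/-- The number of pairs `(a, b) ∈ T × U` with `b < a`. -/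
def crossInv (T U : Finset ℕ) : ℕ := ∑ a ∈ T, (U.filter (· < a)).card

/-- The monomial `t ^ des q ^ inv` of a word. -/
noncomputable def wordWeight (l : List ℕ) : ℤ[X][X] :=
  X ^ desFrom 0 l * C (X ^ wordInv l)

open Classical in
/-- The André I words whose set of letters is `S`. -/
noncomputable def andreIWords (S : Finset ℕ) : Finset (List ℕ) :=
  S.val.lists.toFinset.filter IsAndreI

/-- The descent–inversion polynomial of the André I words with set of letters `S`. -/
noncomputable def wordFI (S : Finset ℕ) : ℤ[X][X] :=
  ∑ l ∈ andreIWords S, wordWeight l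

lemma mem_andreIWords {S : Finset ℕ} {l : List ℕ} :
    l ∈ andreIWords S ↔ l.Nodup ∧ (∀ x, x ∈ l ↔ x ∈ S) ∧ IsAndreI l := by
  classical
  simp only [andreIWords, Finset.mem_filter, Multiset.mem_toFinset,
    Multiset.mem_lists_iff, ← and_assoc]
  refine and_congr_left fun _ => ?_
  constructor
  · intro h
    have h' : S.val = (l : Multiset ℕ) := h
    refine ⟨?_, fun x => ?_⟩
    · rw [← Multiset.coe_nodup, ← h']; exact S.nodup
    · rw [← Finset.mem_val, h', Multiset.mem_coe]
  · rintro ⟨h1, h2⟩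
    exact (Multiset.Nodup.ext S.nodup (Multiset.coe_nodup.2 h1)).2 fun x => by
      simp [h2]

lemma desFrom_append_cons {m : ℕ} (l' : List ℕ) :
    ∀ {a : ℕ} {l : List ℕ}, (a = 0 ∨ m < a) → (∀ x ∈ l, m < x) →
      desFrom a (l ++ m :: l') = desFrom a l + desFrom m l'
  | a, [], ha, _ => by
    have : m < a ↔ 0 < a := by omega
    simp [desFrom, this]
  | a, b :: l, _, hl => by
    simp only [List.mem_cons, forall_eq_or_imp] at hl
    simp only [List.cons_append, desFrom, desFrom_append_cons l' (Or.inr hl.1) hl.2, add_assoc]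

lemma desFrom_eq_desFrom_zero {m : ℕ} {l : List ℕ} (hl : l ≠ []) (h : ∀ x ∈ l, m < x) :
    desFrom m l = desFrom 0 l := by
  cases l with
  | nil => contradiction
  | cons b l =>
    have : ¬ b < m := by simpa using (h b (by simp)).le
    simp [desFrom, this]

lemma wordInv_append (l l' : List ℕ) :
    wordInv (l ++ l') = wordInv l + wordInv l' + (l.map fun a => l'.countP (· < a)).sum := by
  induction l with
  | nil => simp [wordInv]
  | cons a l ih => simp [wordInv, ih, List.countP_append]; omega

lemma sum_map_countP_eq_crossInv {l l' : List ℕ} {T U : Finset ℕ} (hl : l.Nodup)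
    (hl' : l'.Nodup) (hT : ∀ x, x ∈ l ↔ x ∈ T) (hU : ∀ x, x ∈ l' ↔ x ∈ U) :
    (l.map fun a => l'.countP (· < a)).sum = crossInv T U := by
  have hT' : l.toFinset = T := by ext; simp [hT]
  have hU' : l'.toFinset = U := by ext; simp [hU]
  rw [crossInv, ← hT', ← hU', List.sum_toFinset _ hl]
  congr 1
  refine List.map_congr_left fun a _ => ?_
  rw [List.countP_eq_length_filter, ← List.toFinset_card_of_nodup (hl'.filter _),
    List.toFinset_filter]
  simp

lemma wordWeight_append_cons {l l' : List ℕ} {m : ℕ} {T U : Finset ℕ} (hl : l.Nodup)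
    (hl' : l'.Nodup) (hT : ∀ x, x ∈ l ↔ x ∈ T) (hU : ∀ x, x ∈ l' ↔ x ∈ U)
    (hmT : ∀ x ∈ T, m < x) (hmU : ∀ x ∈ U, m < x) (hne : U.Nonempty) :
    wordWeight (l ++ m :: l') =
      C (X ^ (T.card + crossInv T U)) * wordWeight l * wordWeight l' := by
  have hne' : l' ≠ [] := by
    obtain ⟨x, hx⟩ := hne
    exact List.ne_nil_of_mem ((hU x).2 hx)
  have hlen : l.length = T.card := by
    rw [← List.toFinset_card_of_nodup hl]; congr; ext; simp [hT]
  have hdes : desFrom 0 (l ++ m :: l') = desFrom 0 l + desFrom 0 l' := by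
    rw [desFrom_append_cons l' (Or.inl rfl) fun x hx => hmT x ((hT x).1 hx),
      desFrom_eq_desFrom_zero hne' fun x hx => hmU x ((hU x).1 hx)]
  have hcount : l'.countP (· < m) = 0 := by
    simpa [List.countP_eq_zero] using fun x hx => (hmU x ((hU x).1 hx)).le
  have hsum : (l.map fun a => (m :: l').countP (· < a)).sum = T.card + crossInv T U := by
    rw [← sum_map_countP_eq_crossInv hl hl' hT hU, ← hlen]
    have : (l.map fun a => (m :: l').countP (· < a)) =
        l.map fun a => 1 + l'.countP (· < a) := by
      refine List.map_congr_left fun a ha => ?_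
      simp [hmT a ((hT a).1 ha), add_comm]
    rw [this, List.sum_map_add]
    simp
  have hinv : wordInv (l ++ m :: l') = wordInv l + wordInv l' + (T.card + crossInv T U) := by
    rw [wordInv_append, hsum, wordInv, hcount, zero_add]
  simp only [wordWeight, hdes, hinv, pow_add, C_mul]
  ring

lemma sum_powersetCard_pow_crossInv {R : Type*} [CommRing R] (q : R) (S : Finset ℕ) (k : ℕ) :
    ∑ U ∈ S.powersetCard k, q ^ crossInv (S \ U) U = qBinom q S.card k := by
  induction S using Finset.induction_on_max generalizing k with
  | empty => cases k <;> simp [qBinom, crossInv]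
  | insert a S ha ih =>
    have haS : a ∉ S := fun h => lt_irrefl a (ha a h)
    cases k with
    | zero => simp [qBinom, crossInv]
    | succ k =>
      rw [Finset.powersetCard_succ_insert haS, Finset.sum_union, Finset.sum_image,
        Finset.card_insert_of_notMem haS, qBinom, ← ih, ← ih, Finset.mul_sum, add_comm]
      · congr 1
        · refine Finset.sum_congr rfl fun U hU => ?_
          rw [Finset.mem_powersetCard] at hU
          have hs : insert a S \ insert a U = S \ U := by
            ext x; simp only [Finset.mem_sdiff, Finset.mem_insert]; grind
          rw [hs, crossInv, crossInv]
          congr 1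
          refine Finset.sum_congr rfl fun b hb => ?_
          have : ¬ a < b := (ha b (Finset.mem_sdiff.1 hb).1).le.not_gt
          rw [Finset.filter_insert, if_neg this]
        · refine Finset.sum_congr rfl fun U hU => ?_
          rw [Finset.mem_powersetCard] at hU
          have haU : a ∉ U := fun h => haS (hU.1 h)
          have hf : U.filter (· < a) = U :=
            Finset.filter_true_of_mem fun x hx => ha x (hU.1 hx)
          rw [Finset.insert_sdiff_of_notMem _ haU, crossInv, Finset.sum_insert (by simp [haS]),
            hf, hU.2, pow_add, crossInv]
      · intro U hU V hV h
        rw [Finset.mem_coe, Finset.mem_powersetCard] at hU hV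
        rw [← Finset.erase_insert (fun h => haS (hU.1 h)),
          ← Finset.erase_insert (fun h => haS (hV.1 h))]
        rw [h]
      · rw [Finset.disjoint_left]
        intro U hU hU'
        obtain ⟨V, _, rfl⟩ := Finset.mem_image.1 hU'
        exact haS ((Finset.mem_powersetCard.1 hU).1 (Finset.mem_insert_self a V))

lemma wordFI_insert_insert {m M : ℕ} {R : Finset ℕ} (hmM : m < M)
    (hm : ∀ x ∈ R, m < x) (hM : ∀ x ∈ R, x < M) :
    wordFI (insert m (insert M R)) =
      ∑ U ∈ R.powerset, C (X ^ ((R \ U).card + crossInv (R \ U) U)) *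
        wordFI (R \ U) * wordFI (insert M U) := by
  have hcross : ∀ U, crossInv (R \ U) (insert M U) = crossInv (R \ U) U := fun U =>
    Finset.sum_congr rfl fun b hb => by
      rw [Finset.filter_insert, if_neg (hM b (Finset.mem_sdiff.1 hb).1).le.not_gt]
  have hexp : ∀ U ∈ R.powerset, C (X ^ ((R \ U).card + crossInv (R \ U) U)) *
        wordFI (R \ U) * wordFI (insert M U) =
      ∑ p ∈ andreIWords (R \ U) ×ˢ andreIWords (insert M U),
        wordWeight (p.1 ++ m :: p.2) := by
    intro U hU
    rw [Finset.mem_powerset] at hU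
    rw [wordFI, wordFI, mul_assoc, Finset.sum_mul_sum, ← Finset.sum_product', Finset.mul_sum]
    refine Finset.sum_congr rfl fun p hp => ?_
    rw [Finset.mem_product, mem_andreIWords, mem_andreIWords] at hp
    rw [wordWeight_append_cons hp.1.1 hp.2.1 hp.1.2.1 hp.2.2.1
      (fun x hx => hm x (Finset.mem_sdiff.1 hx).1) (by grind) (by simp), hcross, mul_assoc]
  rw [Finset.sum_congr rfl hexp, Finset.sum_sigma', wordFI]
  symm
  refine Finset.sum_bij (fun p _ => p.2.1 ++ m :: p.2.2) ?_ ?_ ?_ fun _ _ => rfl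
  · rintro ⟨U, l, l'⟩ h
    simp only [Finset.mem_sigma, Finset.mem_powerset, Finset.mem_product, mem_andreIWords] at h
    obtain ⟨hU, ⟨hl, hlU, hlA⟩, hl', hlU', hlA'⟩ := h
    rw [mem_andreIWords]
    refine ⟨?_, ?_, .node l l' m M hlA hlA' ?_ ?_ ?_⟩
    · rw [List.nodup_append]
      refine ⟨hl, ?_, ?_⟩
      · rw [List.nodup_cons]
        grind
      · grind
    · intro x
      have := @hU x
      simp only [List.mem_append, List.mem_cons, hlU, hlU', Finset.mem_insert, Finset.mem_sdiff]
      tauto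
    · grind
    · grind
    · grind
  · rintro ⟨U, l, l'⟩ h ⟨V, k, k'⟩ h' heq
    simp only [Finset.mem_sigma, Finset.mem_powerset, Finset.mem_product,
      mem_andreIWords] at h h' heq
    obtain ⟨hU, ⟨hl, hlU, hlA⟩, hl', hlU', hlA'⟩ := h
    obtain ⟨hV, ⟨hk, hkV, hkA⟩, hk', hkV', hkA'⟩ := h'
    have h1 : m ∉ l := by grind
    have h2 : m ∉ l' := by grind
    obtain ⟨rfl, -, rfl⟩ := (List.append_cons_inj_of_notMem h1 h2).1 heq
    have : U = V := by
      ext x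
      have := hlU' x
      have := hkV' x
      grind
    subst this
    rfl
  · intro w hw
    rw [mem_andreIWords] at hw
    obtain ⟨hnd, hmem, hA⟩ := hw
    cases hA with
    | nil => simpa using hmem m
    | single a =>
      have h1 := (hmem m).2 (by simp)
      have h2 := (hmem M).2 (by simp)
      simp only [List.mem_singleton] at h1 h2
      omega
    | node l l' m' M' hl hl' hmin hM' hmax =>
      clear hexp hcross
      simp only [List.mem_append, List.mem_cons, Finset.mem_insert] at hmem hmin hmax
      obtain rfl : m' = m := by
        by_contra hne
        have h1 := (hmem m').1 (by simp)
        have h2 := (hmem m).2 (by simp)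
        have h3 := hm m'
        have h4 := hmin m
        grind
      obtain rfl : M' = M := by
        by_contra hne
        have h1 := (hmem M').1 (by simp [hM'])
        have h2 := (hmem M).2 (by simp)
        have h3 := hM M'
        have h4 := hmax M
        have h5 := hmin M' (Or.inr hM')
        grind
      rw [List.nodup_append, List.nodup_cons] at hnd
      obtain ⟨hnl, ⟨hml', hnl'⟩, hdisj⟩ := hnd
      have hdisj' : ∀ x ∈ l, x ∉ l' := fun x hx hx' => hdisj x hx x (by simp [hx']) rfl
      refine ⟨⟨l'.toFinset.erase M', l, l'⟩, ?_, rfl⟩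
      simp only [Finset.mem_sigma, Finset.mem_powerset, Finset.mem_product, mem_andreIWords]
      refine ⟨?_, ⟨hnl, ?_, hl⟩, hnl', ?_, hl'⟩
      · intro x hx
        rw [Finset.mem_erase, List.mem_toFinset] at hx
        have h1 := (hmem x).1 (by simp [hx.2])
        have h2 := hmin x (Or.inr hx.2)
        rcases h1 with h1 | h1 | h1
        · omega
        · exact absurd h1 hx.1
        · exact h1
      · intro x
        have h1 := hmem x
        have h2 := hdisj' x
        have h3 := hm x
        have h4 := hM x
        have h5 := hmin x
        simp only [Finset.mem_sdiff, Finset.mem_erase, List.mem_toFinset]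
        grind
      · intro x
        simp only [Finset.mem_insert, Finset.mem_erase, List.mem_toFinset]
        by_cases h : x = M' <;> simp [h, hM']


lemma qBinom_eq_zero {R : Type*} [CommRing R] (q : R) {n k : ℕ} (h : n < k) :
    qBinom q n k = 0 := by
  induction n generalizing k with
  | zero => cases k with
    | zero => omega
    | succ k => rfl
  | succ n ih => cases k with
    | zero => omega
    | succ k => rw [qBinom, ih (by omega), ih (by omega), mul_zero, add_zero]

lemma qBinom_self {R : Type*} [CommRing R] (q : R) (n : ℕ) : qBinom q n n = 1 := by
  induction n with
  | zero => rfl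
  | succ n ih => rw [qBinom, ih, qBinom_eq_zero q n.lt_succ_self, mul_zero, add_zero]

lemma wordFI_empty : wordFI ∅ = 1 := by
  have : andreIWords ∅ = {[]} := by
    ext l
    rw [mem_andreIWords, Finset.mem_singleton]
    constructor
    · rintro ⟨-, h, -⟩
      exact List.eq_nil_iff_forall_not_mem.2 fun x hx => by simpa using (h x).1 hx
    · rintro rfl
      exact ⟨List.nodup_nil, by simp, .nil⟩
  simp [wordFI, this, wordWeight, desFrom, wordInv]

lemma wordFI_singleton {a : ℕ} (ha : 0 < a) : wordFI {a} = X := by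
  have : andreIWords {a} = {[a]} := by
    ext l
    rw [mem_andreIWords, Finset.mem_singleton]
    constructor
    · rintro ⟨h, h', -⟩
      have : (l : Multiset ℕ) = {a} :=
        (Multiset.Nodup.ext (Multiset.coe_nodup.2 h) (Multiset.nodup_singleton a)).2 fun x => by
          simp [h']
      simpa using this
    · rintro rfl
      exact ⟨List.nodup_singleton a, by simp, .single a⟩
  simp [wordFI, this, wordWeight, desFrom, wordInv, ha]

lemma wordFI_insert_insert_eq_sum_range {P : ℕ → ℤ[X][X]} {m M : ℕ} {R : Finset ℕ}
    (hm0 : 0 < m) (hmM : m < M) (hm : ∀ x ∈ R, m < x) (hM : ∀ x ∈ R, x < M)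
    (hP : ∀ T : Finset ℕ, (∀ x ∈ T, 0 < x) → T.card ≤ R.card + 1 → wordFI T = P T.card) :
    wordFI (insert m (insert M R)) =
      ∑ k ∈ Finset.range (R.card + 1),
        C (X ^ (R.card - k) * qBinom (X : ℤ[X]) R.card k) * P (k + 1) * P (R.card - k) := by
  rw [wordFI_insert_insert hmM hm hM, Finset.sum_powerset]
  refine Finset.sum_congr rfl fun k _ => ?_
  rw [← sum_powersetCard_pow_crossInv, Finset.mul_sum, map_sum, Finset.sum_mul, Finset.sum_mul]
  refine Finset.sum_congr rfl fun U hU => ?_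
  obtain ⟨hUR, rfl⟩ := Finset.mem_powersetCard.1 hU
  have hpos : ∀ x ∈ R, 0 < x := fun x hx => hm0.trans (hm x hx)
  have hcard := Finset.card_le_card hUR
  have hMU : M ∉ U := fun h => lt_irrefl M (hM M (hUR h))
  have hsdiff : (R \ U).card = R.card - U.card := Finset.card_sdiff_of_subset hUR
  have hins := Finset.card_insert_of_notMem hMU
  rw [hP (R \ U) (fun x hx => hpos x (Finset.mem_sdiff.1 hx).1) (by omega),
    hP (insert M U) ?_ (by omega), hsdiff, hins, pow_add, mul_right_comm]
  intro x hx
  rcases Finset.mem_insert.1 hx with rfl | hx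
  · omega
  · exact hpos x (hUR hx)

lemma exists_eq_insert_insert {S : Finset ℕ} (h : 2 ≤ S.card) :
    ∃ m M R, m < M ∧ (∀ x ∈ R, m < x) ∧ (∀ x ∈ R, x < M) ∧ S.card = R.card + 2 ∧
      S = insert m (insert M R) := by
  have hne : S.Nonempty := Finset.card_pos.1 (by omega)
  have hlt : S.min' hne < S.max' hne := Finset.min'_lt_max'_of_card S h
  have hM : S.max' hne ∈ S.erase (S.min' hne) :=
    Finset.mem_erase.2 ⟨hlt.ne', S.max'_mem hne⟩
  refine ⟨S.min' hne, S.max' hne, (S.erase (S.min' hne)).erase (S.max' hne), hlt, ?_, ?_, ?_, ?_⟩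
  · intro x hx
    exact S.min'_lt_of_mem_erase_min' hne (Finset.mem_erase.1 hx).2
  · intro x hx
    simp only [Finset.mem_erase] at hx
    exact lt_of_le_of_ne (S.le_max' x hx.2.2) hx.1
  · rw [Finset.card_erase_of_mem hM, Finset.card_erase_of_mem (S.min'_mem hne)]
    omega
  · rw [Finset.insert_erase hM, Finset.insert_erase (S.min'_mem hne)]

lemma wordFI_eq_wordFI_Icc (S : Finset ℕ) (hS : ∀ x ∈ S, 0 < x) :
    wordFI S = wordFI (Finset.Icc 1 S.card) := by
  induction hn : S.card using Nat.strong_induction_on generalizing S with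
  | _ n ih =>
    subst hn
    rcases Nat.lt_or_ge S.card 2 with h | h
    · interval_cases hc : S.card
      · rw [Finset.card_eq_zero.1 hc]; rfl
      · obtain ⟨a, rfl⟩ := Finset.card_eq_one.1 hc
        rw [Finset.Icc_self, wordFI_singleton (hS a (by simp)), wordFI_singleton one_pos]
    · have key : ∀ T : Finset ℕ, (∀ x ∈ T, 0 < x) → T.card = S.card →
          wordFI T = ∑ k ∈ Finset.range (S.card - 2 + 1),
            C (X ^ (S.card - 2 - k) * qBinom (X : ℤ[X]) (S.card - 2) k) *
              wordFI (Finset.Icc 1 (k + 1)) * wordFI (Finset.Icc 1 (S.card - 2 - k)) := by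
        intro T hT hTS
        obtain ⟨m, M, R, hmM, hm, hM, hc, rfl⟩ := exists_eq_insert_insert (hTS ▸ h)
        rw [hc] at hTS
        have hR : S.card - 2 = R.card := by omega
        rw [hR]
        exact wordFI_insert_insert_eq_sum_range (P := fun k => wordFI (Finset.Icc 1 k))
          (hT m (by simp)) hmM hm hM fun U hU hUc => ih U.card (by omega) U hU rfl
      rw [key S hS rfl, key (Finset.Icc 1 S.card) (by simp; omega) (by simp)]

lemma card_filter_getD_eq_desFrom (a : ℕ) (l : List ℕ) :
    ((Finset.range (l.length + 1)).filter fun i =>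
      (a :: l).getD (i + 1) 0 < (a :: l).getD i 0).card = desFrom a l := by
  induction l generalizing a with
  | nil => simp [desFrom, Finset.filter_singleton, apply_ite Finset.card]
  | cons b l ih =>
    rw [desFrom, ← ih, Finset.card_filter, Finset.card_filter, List.length_cons,
      Finset.sum_range_succ']
    simp only [List.getD_cons_succ, List.getD_cons_zero]
    rw [add_comm]

lemma wval_eq_getD (n : ℕ) (σ : Equiv.Perm (Fin n)) (i : ℕ) :
    wval n σ i = (0 :: permWord n σ).getD i 0 := by
  cases i with
  | zero => simp [wval]
  | succ i =>
    by_cases h : i < n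
    · simp [wval, permWord, h]
    · simp [wval, permWord, h]

lemma des_eq_desFrom (n : ℕ) (σ : Equiv.Perm (Fin n)) :
    des n σ = desFrom 0 (permWord n σ) := by
  rw [← card_filter_getD_eq_desFrom, des]
  simp only [wval_eq_getD, permWord, List.length_ofFn]

lemma wordInv_ofFn {n : ℕ} (f : Fin n → ℕ) :
    wordInv (List.ofFn f) =
      (Finset.univ.filter fun p : Fin n × Fin n => p.1 < p.2 ∧ f p.2 < f p.1).card := by
  induction n with
  | zero => simp [wordInv]
  | succ n ih =>
    rw [List.ofFn_succ, wordInv, ih, Finset.card_filter, Finset.card_filter,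
      Fintype.sum_prod_type, Fintype.sum_prod_type, Fin.sum_univ_succ]
    congr 1
    · rw [Fin.sum_univ_succ, List.ofFn_eq_map, List.countP_map]
      simp only [lt_self_iff_false, false_and, if_false, zero_add, Fin.succ_pos, true_and]
      rw [← Finset.card_filter, List.countP_eq_length_filter,
        ← List.toFinset_card_of_nodup ((List.nodup_finRange n).filter _)]
      congr 1
      ext i
      simp
    · refine Finset.sum_congr rfl fun i _ => ?_
      rw [Fin.sum_univ_succ]
      simp

lemma inv_eq_wordInv (n : ℕ) (σ : Equiv.Perm (Fin n)) :
    inv n σ = wordInv (permWord n σ) := by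
  rw [permWord, wordInv_ofFn, inv]
  simp

lemma FI_eq_wordFI (n : ℕ) : FI n = wordFI (Finset.Icc 1 n) := by
  classical
  rw [FI, wordFI]
  refine Finset.sum_bij (fun σ _ => permWord n σ) ?_ ?_ ?_ ?_
  · intro σ hσ
    rw [andreIFinset, Finset.mem_filter] at hσ
    rw [mem_andreIWords]
    refine ⟨?_, ?_, hσ.2⟩
    · rw [permWord, List.nodup_ofFn]
      intro i j h
      simpa [Fin.val_inj] using h
    · intro x
      rw [permWord, List.mem_ofFn, Finset.mem_Icc]
      constructor
      · rintro ⟨i, rfl⟩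
        have := (σ i).isLt
        omega
      · rintro ⟨h1, h2⟩
        refine ⟨σ.symm ⟨x - 1, by omega⟩, ?_⟩
        simp only [Equiv.apply_symm_apply]
        omega
  · intro σ _ τ _ h
    ext i
    simpa using congrFun (List.ofFn_injective h) i
  · intro l hl
    rw [mem_andreIWords] at hl
    obtain ⟨hnd, hmem, hA⟩ := hl
    have hlen : l.length = n := by
      rw [← List.toFinset_card_of_nodup hnd,
        show l.toFinset = Finset.Icc 1 n by ext x; rw [List.mem_toFinset, hmem]]
      simp
    subst hlen
    have hb : ∀ i : Fin l.length, 1 ≤ l.get i ∧ l.get i ≤ l.length := fun i =>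
      Finset.mem_Icc.1 ((hmem _).1 (l.get_mem i))
    let f : Fin l.length → Fin l.length := fun i => ⟨l.get i - 1, by have := hb i; omega⟩
    have hf : Function.Injective f := by
      intro i j h
      have h' : l.get i - 1 = l.get j - 1 := congrArg Fin.val h
      have hi := hb i
      have hj := hb j
      exact hnd.injective_get (by omega)
    let σ := Equiv.ofBijective f (Finite.injective_iff_bijective.1 hf)
    have hw : permWord l.length σ = l := by
      conv_rhs => rw [← List.ofFn_get l]
      rw [permWord]
      congr 1
      funext i
      have := hb i
      change l.get i - 1 + 1 = l.get i
      omega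
    refine ⟨σ, ?_, hw⟩
    rw [andreIFinset, Finset.mem_filter, hw]
    exact ⟨Finset.mem_univ _, hA⟩
  · intro σ _
    rw [wordWeight, des_eq_desFrom, inv_eq_wordInv]

end Andre

/-- the recurrence
`F^I_{n+1} = F^I_n + Σ_{k=0}^{n−2} q^{n−k−1}·[n−1 choose k]_q·F^I_{k+1}·F^I_{n−k−1}`. -/
theorem FI_recurrence (n : ℕ) (hn : 1 ≤ n) :
    FI (n + 1) =
      FI n + ∑ k ∈ Finset.range (n - 1),
        Polynomial.C (Polynomial.X ^ (n - k - 1) * qBinom (Polynomial.X : Polynomial ℤ) (n - 1) k) *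
          FI (k + 1) * FI (n - k - 1) := by
  obtain ⟨n, rfl⟩ := Nat.exists_eq_add_of_le' hn
  obtain ⟨m, M, R, hmM, hm, hM, hc, hS⟩ :=
    exists_eq_insert_insert (S := Finset.Icc 1 (n + 1 + 1)) (by simp)
  have hR : R.card = n := by simp at hc; omega
  have h0 : FI 0 = 1 := by rw [FI_eq_wordFI, Finset.Icc_eq_empty (by simp), wordFI_empty]
  have hm0 : 0 < m := by
    have : m ∈ Finset.Icc 1 (n + 1 + 1) := by rw [hS]; exact Finset.mem_insert_self m _
    exact (Finset.mem_Icc.1 this).1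
  have key := wordFI_insert_insert_eq_sum_range (P := FI) hm0 hmM hm hM
    fun T hT _ => (wordFI_eq_wordFI_Icc T hT).trans (FI_eq_wordFI _).symm
  rw [FI_eq_wordFI (n + 1 + 1), hS, key, hR, Finset.sum_range_succ, add_comm]
  refine congrArg₂ (· + ·) ?_ ?_
  · simp [qBinom_self, h0]
  · refine Finset.sum_congr rfl fun k _ => ?_
    rw [Nat.add_sub_cancel, show n + 1 - k - 1 = n - k by omega]
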